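/- Suppose τ admits ∂ₓτ at every point and satisfies the differential Fay identity. Let t : ℕ → ℂ be finitely supported, and let λ, μ be nonzero complex numbers with λ ≠ ±μ, τ(t) ≠ 0 and τ(t+2[λ⁻¹]) ≠ 0. Then ψ(t,μ)·∂ₓ[ψ(·,−λ)](t) = (1/2)·∂ₓ[ψ(·,−λ)·(ψ(·+2[λ⁻¹],μ) + ψ(·,μ))](t), where ψ(t,μ) = exp(ξ(t,μ))·τ(t−2[μ⁻¹])/τ(t), ψ(t,−λ) = exp(−ξ(t,λ))·τ(t+2[λ⁻¹])/τ(t), ψ(t+2[λ⁻¹],μ) = exp(ξ(t,μ))·((λ+μ)/(λ−μ))·τ(t+2[λ⁻¹]−2[μ⁻¹])/τ(t+2[λ⁻¹]), and ∂ₓ is applied to each bracketed expression as a function of t via the first coordinate. (This is the Baker–Akhiezer instance of the x-derivative form of eq. (3.22)/Corollary 3.4(ii): S(Φ(t), ∂ₓψ_BA(t,−λ)) = ½ψ_BA(t,−λ)·(Φ(t+2[λ⁻¹]) + Φ(t)) with Φ = ψ_BA(·,μ).) -/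

import Mathlib

open Complex

noncomputable section

/-- The shifted time sequence `t + 2[s]`, given by `(t + 2[s]) n = t n + 2 s^(2n+1)/(2n+1)`. -/
def shift (t : ℕ → ℂ) (s : ℂ) : ℕ → ℂ :=
  fun n => t n + 2 * s ^ (2 * n + 1) / ((2 * n + 1 : ℕ) : ℂ)

/-- `ξ(t,z) = Σ_n t_n z^(2n+1)` (a finite sum for finitely supported `t`). -/
def xi (t : ℕ → ℂ) (z : ℂ) : ℂ := ∑ᶠ n : ℕ, t n * z ^ (2 * n + 1)

/-- Derivative with respect to `x = t₁` (coordinate `0`). -/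
def dx (F : (ℕ → ℂ) → ℂ) (t : ℕ → ℂ) : ℂ :=
  deriv (fun y => F (Function.update t 0 y)) (t 0)

/-- The Fay identity of the BKP hierarchy. -/
def FayIdentity (τ : (ℕ → ℂ) → ℂ) : Prop :=
  ∀ (t : ℕ → ℂ) (s₀ s₁ s₂ s₃ : ℂ),
    s₁ + s₀ ≠ 0 → s₂ + s₀ ≠ 0 → s₃ + s₀ ≠ 0 →
    s₁ - s₂ ≠ 0 → s₁ - s₃ ≠ 0 → s₂ - s₃ ≠ 0 →
    (s₁ - s₀) * (s₁ + s₂) * (s₁ + s₃) / ((s₁ + s₀) * (s₁ - s₂) * (s₁ - s₃)) *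
        (τ (shift (shift t s₂) s₃) * τ (shift (shift t s₀) s₁))
      + (s₂ - s₀) * (s₂ + s₃) * (s₂ + s₁) / ((s₂ + s₀) * (s₂ - s₃) * (s₂ - s₁)) *
        (τ (shift (shift t s₃) s₁) * τ (shift (shift t s₀) s₂))
      + (s₃ - s₀) * (s₃ + s₁) * (s₃ + s₂) / ((s₃ + s₀) * (s₃ - s₁) * (s₃ - s₂)) *
        (τ (shift (shift t s₁) s₂) * τ (shift (shift t s₀) s₃))
      + (s₀ - s₁) * (s₀ - s₂) * (s₀ - s₃) / ((s₀ + s₁) * (s₀ + s₂) * (s₀ + s₃)) *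
        (τ (shift (shift (shift (shift t s₀) s₁) s₂) s₃) * τ t) = 0

/-- The differential Fay identity of the BKP hierarchy. -/
def DiffFay (τ : (ℕ → ℂ) → ℂ) : Prop :=
  ∀ (t : ℕ → ℂ) (s₁ s₂ : ℂ), s₁ ≠ 0 → s₂ ≠ 0 →
    (1 / s₂ ^ 2 - 1 / s₁ ^ 2) *
        (τ (shift t s₁) * τ (shift t s₂) - τ (shift (shift t s₁) s₂) * τ t)
      = (1 / s₂ + 1 / s₁) *
          (dx τ (shift t s₂) * τ (shift t s₁) - dx τ (shift t s₁) * τ (shift t s₂))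
        + (1 / s₂ - 1 / s₁) *
          (τ (shift (shift t s₁) s₂) * dx τ t - dx τ (shift (shift t s₁) s₂) * τ t)

theorem shift_update_zero (t : ℕ → ℂ) (s y : ℂ) :
    shift (Function.update t 0 y) s = Function.update (shift t s) 0 (y + 2 * s) := by
  funext n
  rcases eq_or_ne n 0 with rfl | hn
  · simp [shift]
  · simp [shift, hn]

theorem shift_apply_zero (t : ℕ → ℂ) (s : ℂ) : shift t s 0 = t 0 + 2 * s := by
  simp [shift]

/-- Differentiation in the first time commutes with shifts of the times. -/
theorem hasDerivAt_comp_shift {F : (ℕ → ℂ) → ℂ} {t : ℕ → ℂ} {s F' : ℂ}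
    (h : HasDerivAt (fun y => F (Function.update (shift t s) 0 y)) F' (shift t s 0)) :
    HasDerivAt (fun y => F (shift (Function.update t 0 y) s)) F' (t 0) := by
  simp only [shift_update_zero]
  rw [shift_apply_zero] at h
  exact h.comp_add_const (t 0) (2 * s)

theorem hasDerivAt_dx {F : (ℕ → ℂ) → ℂ} {t : ℕ → ℂ}
    (h : DifferentiableAt ℂ (fun y => F (Function.update t 0 y)) (t 0)) :
    HasDerivAt (fun y => F (Function.update t 0 y)) (dx F t) (t 0) :=
  h.hasDerivAt

theorem xi_update_zero {t : ℕ → ℂ} (hsupp : (Function.support t).Finite) (z y : ℂ) :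
    xi (Function.update t 0 y) z = xi t z + (y - t 0) * z := by
  have hsplit : ∀ n, Function.update t 0 y n * z ^ (2 * n + 1) =
      t n * z ^ (2 * n + 1) + Pi.single (M := fun _ => ℂ) 0 ((y - t 0) * z) n := by
    intro n
    rcases eq_or_ne n 0 with rfl | hn
    · simp; ring
    · simp [hn]
  have hsingle : (Function.support (Pi.single (M := fun _ => ℂ) (0 : ℕ) ((y - t 0) * z))).Finite :=
    (Set.finite_singleton 0).subset Pi.support_single_subset
  rw [xi, finsum_congr hsplit, finsum_add_distrib (hsupp.subset ?_) hsingle, xi,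
    finsum_eq_single (Pi.single (M := fun _ => ℂ) (0 : ℕ) ((y - t 0) * z)) 0
      fun n hn => by simp [hn],
    Pi.single_eq_same]
  exact Function.support_mul_subset_left _ _

theorem hasDerivAt_xi {t : ℕ → ℂ} (hsupp : (Function.support t).Finite) (z : ℂ) :
    HasDerivAt (fun y => xi (Function.update t 0 y) z) z (t 0) := by
  simp only [xi_update_zero hsupp]
  simpa using (((hasDerivAt_id (t 0)).sub_const (t 0)).mul_const z).const_add (xi t z)

/-- The Baker–Akhiezer instance of the x-derivative form of eq. (3.22):
`S(Φ(t), ∂ₓψ_BA(t,−λ)) = ½ ψ_BA(t,−λ)(Φ(t+2[λ⁻¹]) + Φ(t))` with `Φ = ψ_BA(·,μ)`. -/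
theorem sep_phi_x_derivative (τ : (ℕ → ℂ) → ℂ)
    (hdiff : ∀ t : ℕ → ℂ, DifferentiableAt ℂ (fun y => τ (Function.update t 0 y)) (t 0))
    (hdFay : DiffFay τ)
    (t : ℕ → ℂ) (hsupp : (Function.support t).Finite)
    (lam μ : ℂ) (hlam : lam ≠ 0) (hmu : μ ≠ 0)
    (hlm : lam ≠ μ) (hlm' : lam ≠ -μ)
    (ht : τ t ≠ 0) (htl : τ (shift t lam⁻¹) ≠ 0) :
    (Complex.exp (xi t μ) * τ (shift t (-μ⁻¹)) / τ t) *
        dx (fun u => Complex.exp (-xi u lam) * τ (shift u lam⁻¹) / τ u) t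
      = (1 / 2) *
          dx (fun u =>
            (Complex.exp (-xi u lam) * τ (shift u lam⁻¹) / τ u) *
            (Complex.exp (xi u μ) * ((lam + μ) / (lam - μ)) *
                τ (shift (shift u lam⁻¹) (-μ⁻¹)) / τ (shift u lam⁻¹)
              + Complex.exp (xi u μ) * τ (shift u (-μ⁻¹)) / τ u)) t := by
  have ha := hasDerivAt_dx (hdiff t)
  have hb := hasDerivAt_comp_shift (hasDerivAt_dx (hdiff (shift t lam⁻¹)))
  have hc := hasDerivAt_comp_shift (hasDerivAt_dx (hdiff (shift t (-μ⁻¹))))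
  have hd := hasDerivAt_comp_shift (F := fun u => τ (shift u (-μ⁻¹)))
    (hasDerivAt_comp_shift (hasDerivAt_dx (hdiff (shift (shift t lam⁻¹) (-μ⁻¹)))))
  have hE := (hasDerivAt_xi hsupp lam).neg.cexp
  have hM := (hasDerivAt_xi hsupp μ).cexp
  have hψ := (hE.mul hb).div ha (by simpa using ht)
  have hφ := ((hM.mul_const ((lam + μ) / (lam - μ))).mul hd).div hb (by simpa using htl)
  have hprod := hψ.mul (hφ.add ((hM.mul hc).div ha (by simpa using ht)))
  have hFay := hdFay t lam⁻¹ (-μ⁻¹) (by simpa using hlam) (by simpa using hmu)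
  have hL : dx (fun u => Complex.exp (-xi u lam) * τ (shift u lam⁻¹) / τ u) t = _ := hψ.deriv
  have hR : dx (fun u =>
      (Complex.exp (-xi u lam) * τ (shift u lam⁻¹) / τ u) *
      (Complex.exp (xi u μ) * ((lam + μ) / (lam - μ)) *
          τ (shift (shift u lam⁻¹) (-μ⁻¹)) / τ (shift u lam⁻¹)
        + Complex.exp (xi u μ) * τ (shift u (-μ⁻¹)) / τ u)) t = _ := hprod.deriv
  rw [hL, hR]
  simp only [Pi.mul_apply, Pi.add_apply, Pi.div_apply, Pi.neg_apply, Function.update_eq_self]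
  have hsub : lam - μ ≠ 0 := sub_ne_zero.mpr hlm
  simp only [one_div, inv_neg, inv_inv, inv_pow, even_two, Even.neg_pow] at hFay
  generalize dx τ (shift (shift t lam⁻¹) (-μ⁻¹)) = d' at *
  generalize dx τ (shift t lam⁻¹) = b' at *
  generalize dx τ (shift t (-μ⁻¹)) = c' at *
  generalize dx τ t = a' at *
  generalize τ (shift (shift t lam⁻¹) (-μ⁻¹)) = d at *
  generalize τ (shift t lam⁻¹) = b at *
  generalize τ (shift t (-μ⁻¹)) = c at *
  generalize τ t = a at *
  generalize Complex.exp (-xi t lam) = E at *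
  generalize Complex.exp (xi t μ) = M at *
  clear hE hM hψ hφ hprod hL hR ha hb hc hd hdFay hdiff
  field_simp
  linear_combination E * M * a * b * hFay
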